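/- arXiv:2304.10923 — 3 statements merged into one kernel-verified Lean document; each statement's English description precedes it below -/
import Mathlib

section
/- Let E ⊆ ℝ^n be a set of finite perimeter in an open set U and let H₁, H₂ ∈ L¹(U) both be local variational mean curvatures of E in U. Then the composed function Ĥ := H₁·1_{E∩U} + H₂·1_{U∖E} is also a local variational mean curvature of E in U. -/
open MeasureTheory Metric Set
open scoped ENNReal symmDiff

/-- The perimeter of `E` relative to `U ⊆ ℝ^n`, via the classical supremum over
compactly supported `C¹` vector fields of norm at most one. -/
noncomputable def perim (n : ℕ) (E U : Set (EuclideanSpace ℝ (Fin n))) : ℝ≥0∞ :=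
  ⨆ (φ : EuclideanSpace ℝ (Fin n) → EuclideanSpace ℝ (Fin n)) (_ : ContDiff ℝ 1 φ)
    (_ : HasCompactSupport φ) (_ : tsupport φ ⊆ U) (_ : ∀ x, ‖φ x‖ ≤ 1),
    ENNReal.ofReal (∫ x in E, ∑ i, fderiv ℝ φ x (EuclideanSpace.single i 1) i)

/-- Massari's functional `F_H^U(F) = P(F,U) - ∫_{F∩U} H`, valued in `EReal` to allow
competitors of infinite perimeter. -/
noncomputable def massariF (n : ℕ) (H : EuclideanSpace ℝ (Fin n) → ℝ)
    (U F : Set (EuclideanSpace ℝ (Fin n))) : EReal :=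
  (perim n F U : EReal) - ((∫ x in F ∩ U, H x : ℝ) : EReal)

/-- `H` is a local variational mean curvature of `E` in `U`: `E` minimizes `F_H^U`
among measurable `F` with `F ∆ E ⋐ U`. -/
def IsLocVMC (n : ℕ) (H : EuclideanSpace ℝ (Fin n) → ℝ)
    (E U : Set (EuclideanSpace ℝ (Fin n))) : Prop :=
  ∀ F : Set (EuclideanSpace ℝ (Fin n)), MeasurableSet F →
    IsCompact (closure (F ∆ E)) → closure (F ∆ E) ⊆ U →
    massariF n H U E ≤ massariF n H U F

open Filter Topology Convolution ContinuousLinearMap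

/-- The divergence of a vector field on `ℝ^n`. -/
noncomputable def vecDiv {n : ℕ} (φ : EuclideanSpace ℝ (Fin n) → EuclideanSpace ℝ (Fin n))
    (x : EuclideanSpace ℝ (Fin n)) : ℝ :=
  ∑ i, fderiv ℝ φ x (EuclideanSpace.single i 1) i

/-- The admissible vector fields in the definition of the perimeter in `U`. -/
structure IsTestField {n : ℕ} (U : Set (EuclideanSpace ℝ (Fin n)))
    (φ : EuclideanSpace ℝ (Fin n) → EuclideanSpace ℝ (Fin n)) : Prop where
  contDiff : ContDiff ℝ 1 φ
  compact : HasCompactSupport φ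
  tsupport_subset : tsupport φ ⊆ U
  norm_le : ∀ x, ‖φ x‖ ≤ 1

section Divergence

variable {n : ℕ} {U E : Set (EuclideanSpace ℝ (Fin n))}
  {φ : EuclideanSpace ℝ (Fin n) → EuclideanSpace ℝ (Fin n)}

lemma isTestField_zero : IsTestField U (0 : EuclideanSpace ℝ (Fin n) → _) where
  contDiff := contDiff_const
  compact := HasCompactSupport.zero
  tsupport_subset := by simp [tsupport]
  norm_le := by simp

lemma vecDiv_zero : vecDiv (0 : EuclideanSpace ℝ (Fin n) → EuclideanSpace ℝ (Fin n)) = 0 := by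
  ext x
  simp [vecDiv]

lemma continuous_vecDiv (hφ : ContDiff ℝ 1 φ) : Continuous (vecDiv φ) := by
  have := hφ.continuous_fderiv one_ne_zero
  unfold vecDiv
  fun_prop

lemma hasCompactSupport_vecDiv (hc : HasCompactSupport φ) : HasCompactSupport (vecDiv φ) := by
  refine (hc.fderiv ℝ).mono fun x hx => ?_
  contrapose! hx
  simp only [Function.mem_support, not_not] at hx ⊢
  simp [vecDiv, hx]

lemma IsTestField.integrable_vecDiv (hφ : IsTestField U φ) : Integrable (vecDiv φ) :=
  (continuous_vecDiv hφ.contDiff).integrable_of_hasCompactSupport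
    (hasCompactSupport_vecDiv hφ.compact)

lemma IsTestField.integral_le_perim (hφ : IsTestField U φ) (hE : perim n E U ≠ ⊤) :
    ∫ x in E, vecDiv φ x ≤ (perim n E U).toReal := by
  rw [← ENNReal.ofReal_le_iff_le_toReal hE]
  exact le_iSup_of_le φ <| le_iSup_of_le hφ.contDiff <| le_iSup_of_le hφ.compact <|
    le_iSup_of_le hφ.tsupport_subset <| le_iSup_of_le hφ.norm_le le_rfl

lemma perim_le_ofReal {c : ℝ}
    (h : ∀ φ, IsTestField U φ → ∫ x in E, vecDiv φ x ≤ c) :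
    perim n E U ≠ ⊤ ∧ (perim n E U).toReal ≤ c := by
  have hc : 0 ≤ c := by simpa [vecDiv_zero] using h 0 isTestField_zero
  have key : perim n E U ≤ ENNReal.ofReal c := by
    refine iSup_le fun φ => iSup_le fun h1 => iSup_le fun h2 => iSup_le fun h3 =>
      iSup_le fun h4 => ENNReal.ofReal_le_ofReal (h φ ⟨h1, h2, h3, h4⟩)
  refine ⟨(key.trans_lt ENNReal.ofReal_lt_top).ne, ?_⟩
  exact ENNReal.toReal_le_of_le_ofReal hc key

lemma vecDiv_comp_add_right (y x : EuclideanSpace ℝ (Fin n)) :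
    vecDiv (fun z => φ (z + y)) x = vecDiv φ (x + y) := by
  simp [vecDiv, fderiv_comp_add_right]

/-- Translating a test field by less than the distance of its support to the complement of `U`
yields a test field. -/
lemma IsTestField.comp_add_right {r : ℝ} (hφ : IsTestField U φ)
    (hr : cthickening r (tsupport φ) ⊆ U) {y : EuclideanSpace ℝ (Fin n)} (hy : ‖y‖ ≤ r) :
    IsTestField U (fun z => φ (z + y)) where
  contDiff := hφ.contDiff.comp (contDiff_id.add contDiff_const)
  compact := hφ.compact.comp_homeomorph (Homeomorph.addRight y)
  tsupport_subset := by
    intro x hx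
    apply hr
    refine mem_cthickening_of_dist_le x (x + y) r _ ?_ (by simpa using hy)
    exact tsupport_comp_subset_preimage φ (f := fun z => z + y) (by fun_prop) hx
  norm_le x := hφ.norm_le _

/-- Integration by parts against a compactly supported vector field. -/
lemma integral_mul_vecDiv {a : EuclideanSpace ℝ (Fin n) → ℝ} (ha : ContDiff ℝ 1 a)
    (hφ : ContDiff ℝ 1 φ) (hc : HasCompactSupport φ) :
    ∫ x, a x * vecDiv φ x = - ∫ x, fderiv ℝ a x (φ x) := by
  have hda := ha.continuous_fderiv one_ne_zero
  have hdφ := hφ.continuous_fderiv one_ne_zero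
  have hφc := hφ.continuous
  have hac := ha.continuous
  have hci (i : Fin n) : HasCompactSupport fun x => φ x i :=
    hc.comp_left (g := fun v : EuclideanSpace ℝ (Fin n) => v i) rfl
  have hfd (i : Fin n) (x v) : fderiv ℝ (fun x => φ x i) x v = fderiv ℝ φ x v i := by
    have h1 : HasFDerivAt (fun x => φ x i) ((EuclideanSpace.proj i).comp (fderiv ℝ φ x)) x :=
      (EuclideanSpace.proj (𝕜 := ℝ) i).hasFDerivAt.comp x
        (hφ.differentiable one_ne_zero x).hasFDerivAt
    rw [h1.fderiv]
    rfl
  have hi1 (i : Fin n) : Integrable fun x =>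
      a x * fderiv ℝ φ x (EuclideanSpace.single i 1) i := by
    refine Continuous.integrable_of_hasCompactSupport (by fun_prop) ?_
    refine HasCompactSupport.mul_left ?_
    refine (hc.fderiv ℝ).mono fun x hx => ?_
    contrapose! hx
    simp only [Function.mem_support, not_not] at hx ⊢
    simp [hx]
  have hi2 (i : Fin n) : Integrable fun x =>
      fderiv ℝ a x (EuclideanSpace.single i 1) * φ x i :=
    Continuous.integrable_of_hasCompactSupport (by fun_prop) (hci i).mul_left
  have hi3 (i : Fin n) : Integrable fun x => a x * φ x i :=
    Continuous.integrable_of_hasCompactSupport (by fun_prop) (hci i).mul_left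
  have hsum (x) : fderiv ℝ a x (φ x) =
      ∑ i, fderiv ℝ a x (EuclideanSpace.single i 1) * φ x i := by
    conv_lhs => rw [← (EuclideanSpace.basisFun (Fin n) ℝ).sum_repr (φ x)]
    simp [map_sum, mul_comm]
  simp_rw [hsum, vecDiv, Finset.mul_sum]
  rw [integral_finsetSum _ fun i _ => hi1 i, integral_finsetSum _ fun i _ => hi2 i,
    ← Finset.sum_neg_distrib]
  refine Finset.sum_congr rfl fun i _ => ?_
  have := integral_mul_fderiv_eq_neg_fderiv_mul_of_integrable (μ := volume) (f := a)
    (g := fun x => φ x i) (v := EuclideanSpace.single i 1) (hi2 i)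
    (by simpa only [hfd] using hi1 i) (hi3 i)
    (fun x _ => ha.differentiable one_ne_zero x)
    (fun x _ => by
      have := hφ.differentiable one_ne_zero
      fun_prop)
  simpa only [hfd] using this

end Divergence

section Mollification

variable {n : ℕ} {U E : Set (EuclideanSpace ℝ (Fin n))}
  {φ : EuclideanSpace ℝ (Fin n) → EuclideanSpace ℝ (Fin n)}

/-- The mollified characteristic function of `E`. -/
noncomputable def mollify {n : ℕ} (ρ : ContDiffBump (0 : EuclideanSpace ℝ (Fin n)))
    (E : Set (EuclideanSpace ℝ (Fin n))) (x : EuclideanSpace ℝ (Fin n)) : ℝ :=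
  ∫ t, ρ.normed volume t * E.indicator (fun _ => (1 : ℝ)) (x - t)

lemma mollify_eq_convolution (ρ : ContDiffBump (0 : EuclideanSpace ℝ (Fin n))) :
    mollify ρ E = (ρ.normed volume ⋆[lsmul ℝ ℝ, volume] E.indicator fun _ => (1 : ℝ)) := rfl

lemma locallyIntegrable_indicator_one (hE : MeasurableSet E) :
    LocallyIntegrable (E.indicator fun _ => (1 : ℝ)) :=
  (locallyIntegrable_const 1).indicator hE

lemma contDiff_mollify (ρ : ContDiffBump (0 : EuclideanSpace ℝ (Fin n)))
    (hE : MeasurableSet E) : ContDiff ℝ 1 (mollify ρ E) :=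
  ρ.hasCompactSupport_normed.contDiff_convolution_left (n := 1) (lsmul ℝ ℝ) ρ.contDiff_normed
    (locallyIntegrable_indicator_one hE)

lemma mollify_mem_Icc (ρ : ContDiffBump (0 : EuclideanSpace ℝ (Fin n)))
    (x : EuclideanSpace ℝ (Fin n)) : mollify ρ E x ∈ Icc (0 : ℝ) 1 := by
  constructor
  · exact integral_nonneg fun t =>
      mul_nonneg (ρ.nonneg_normed t) (indicator_nonneg (fun _ _ => zero_le_one) _)
  · rw [← ρ.integral_normed (μ := volume)]
    refine integral_mono_of_nonneg (Eventually.of_forall fun t => ?_) ρ.integrable_normed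
      (Eventually.of_forall fun t => ?_)
    · exact mul_nonneg (ρ.nonneg_normed t) (indicator_nonneg (fun _ _ => zero_le_one) _)
    · refine mul_le_of_le_one_right (ρ.nonneg_normed t) ?_
      exact indicator_le_self' (fun _ _ => zero_le_one) _

lemma integral_mollify_mul_vecDiv_le (ρ : ContDiffBump (0 : EuclideanSpace ℝ (Fin n)))
    (hEm : MeasurableSet E) (hE : perim n E U ≠ ⊤) (hφ : IsTestField U φ)
    (hr : cthickening ρ.rOut (tsupport φ) ⊆ U) :
    ∫ x, mollify ρ E x * vecDiv φ x ≤ (perim n E U).toReal := by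
  set P := (perim n E U).toReal
  let S : Set (EuclideanSpace ℝ (Fin n) × EuclideanSpace ℝ (Fin n)) := {p | p.1 - p.2 ∈ E}
  have hS : MeasurableSet S := (measurable_fst.sub measurable_snd) hEm
  have hint : Integrable (S.indicator fun p => vecDiv φ p.1 * ρ.normed volume p.2)
      (volume.prod volume) :=
    (hφ.integrable_vecDiv.mul_prod ρ.integrable_normed).indicator hS
  have hF (x t) : S.indicator (fun p => vecDiv φ p.1 * ρ.normed volume p.2) (x, t) =
      ρ.normed volume t * E.indicator (fun _ => (1 : ℝ)) (x - t) * vecDiv φ x := by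
    by_cases h : x - t ∈ E <;> simp [S, h, mul_comm]
  have hinner (t) : ∫ x, S.indicator (fun p => vecDiv φ p.1 * ρ.normed volume p.2) (x, t) =
      ρ.normed volume t * ∫ x in E, vecDiv φ (x + t) := by
    simp_rw [hF, mul_assoc]
    rw [integral_const_mul, ← integral_indicator hEm,
      ← integral_add_right_eq_self
        (fun x => E.indicator (fun _ => (1 : ℝ)) (x - t) * vecDiv φ x) t]
    congr 1
    refine integral_congr_ae (Eventually.of_forall fun x => ?_)
    by_cases h : x ∈ E <;> simp [h]
  calc ∫ x, mollify ρ E x * vecDiv φ x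
      = ∫ x, ∫ t, S.indicator (fun p => vecDiv φ p.1 * ρ.normed volume p.2) (x, t) := by
        simp_rw [hF, integral_mul_const, mollify]
    _ = ∫ t, ρ.normed volume t * ∫ x in E, vecDiv φ (x + t) := by
        rw [integral_integral_swap (f := fun x t =>
          S.indicator (fun p => vecDiv φ p.1 * ρ.normed volume p.2) (x, t)) hint]
        simp_rw [hinner]
    _ ≤ ∫ t, ρ.normed volume t * P := by
        refine integral_mono ?_ (ρ.integrable_normed.mul_const P) fun t => ?_
        · simpa only [hinner] using hint.integral_prod_right
        · by_cases ht : t ∈ Function.support (ρ.normed volume)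
          · refine mul_le_mul_of_nonneg_left ?_ (ρ.nonneg_normed t)
            rw [ρ.support_normed_eq, mem_ball_zero_iff] at ht
            simpa only [vecDiv_comp_add_right] using
              (hφ.comp_add_right hr ht.le).integral_le_perim hE
          · simp [Function.notMem_support.mp ht]
    _ = P := by rw [integral_mul_const, ρ.integral_normed, one_mul]

end Mollification

section Submodularity

variable {n : ℕ} {U E F : Set (EuclideanSpace ℝ (Fin n))}
  {φ ψ : EuclideanSpace ℝ (Fin n) → EuclideanSpace ℝ (Fin n)}

lemma tsupport_smul_add_smul_subset (a b : EuclideanSpace ℝ (Fin n) → ℝ) :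
    tsupport (fun x => a x • φ x + b x • ψ x) ⊆ tsupport φ ∪ tsupport ψ :=
  (tsupport_add _ _).trans
    (union_subset_union (tsupport_smul_subset_right a φ) (tsupport_smul_subset_right b ψ))

lemma IsTestField.convexComb (hφ : IsTestField U φ) (hψ : IsTestField U ψ)
    {a b : EuclideanSpace ℝ (Fin n) → ℝ} (ha : ContDiff ℝ 1 a) (hb : ContDiff ℝ 1 b)
    (ha0 : ∀ x, 0 ≤ a x) (hb0 : ∀ x, 0 ≤ b x) (hab : ∀ x, a x + b x = 1) :
    IsTestField U fun x => a x • φ x + b x • ψ x where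
  contDiff := (ha.smul hφ.contDiff).add (hb.smul hψ.contDiff)
  compact := (hφ.compact.isCompact.union hψ.compact.isCompact).of_isClosed_subset
    (isClosed_tsupport _) (tsupport_smul_add_smul_subset a b)
  tsupport_subset := (tsupport_smul_add_smul_subset a b).trans
    (union_subset hφ.tsupport_subset hψ.tsupport_subset)
  norm_le x := by
    have h := convex_closedBall (0 : EuclideanSpace ℝ (Fin n)) 1
      (mem_closedBall_zero_iff.2 (hφ.norm_le x)) (mem_closedBall_zero_iff.2 (hψ.norm_le x))
      (ha0 x) (hb0 x) (hab x)
    simpa using h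

/-- A smooth approximation of the absolute value. -/
noncomputable def smoothAbs (δ t : ℝ) : ℝ := √(t ^ 2 + δ ^ 2)

lemma smoothAbs_pos {δ : ℝ} (hδ : 0 < δ) (t : ℝ) : 0 < smoothAbs δ t :=
  Real.sqrt_pos.2 (by positivity)

lemma abs_le_smoothAbs (δ t : ℝ) : |t| ≤ smoothAbs δ t :=
  Real.abs_le_sqrt (by nlinarith [sq_nonneg δ])

lemma smoothAbs_le {δ : ℝ} (hδ : 0 ≤ δ) (t : ℝ) : smoothAbs δ t ≤ |t| + δ := by
  refine Real.sqrt_le_iff.2 ⟨by positivity, ?_⟩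
  nlinarith [sq_abs t, mul_nonneg (abs_nonneg t) hδ]

lemma contDiff_smoothAbs {δ : ℝ} (hδ : 0 < δ) : ContDiff ℝ 1 (smoothAbs δ) :=
  ContDiff.sqrt (by fun_prop) fun t => by positivity

lemma hasDerivAt_smoothAbs {δ : ℝ} (hδ : 0 < δ) (t : ℝ) :
    HasDerivAt (smoothAbs δ) (t / smoothAbs δ t) t := by
  have h := (((hasDerivAt_id t).pow 2).add_const (δ ^ 2)).sqrt (by simp; positivity)
  refine h.congr_deriv ?_
  simp [smoothAbs]
  field_simp

lemma integrable_fderiv_apply {a : EuclideanSpace ℝ (Fin n) → ℝ} (ha : ContDiff ℝ 1 a)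
    (hφ : IsTestField U φ) : Integrable fun x => fderiv ℝ a x (φ x) := by
  have hda := ha.continuous_fderiv one_ne_zero
  have hφc := hφ.contDiff.continuous
  refine Continuous.integrable_of_hasCompactSupport (by fun_prop) (hφ.compact.mono fun x hx => ?_)
  contrapose! hx
  simp only [Function.mem_support, not_not] at hx ⊢
  simp [hx]

/-- The duality form of `|∇ min(u,v)| + |∇ max(u,v)| ≤ |∇u| + |∇v|`, for smooth approximations of
the minimum and the maximum. -/
lemma exists_testField_smooth_min_max {u v : EuclideanSpace ℝ (Fin n) → ℝ}
    (hu : ContDiff ℝ 1 u) (hv : ContDiff ℝ 1 v) (hφ : IsTestField U φ) (hψ : IsTestField U ψ)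
    {δ : ℝ} (hδ : 0 < δ) :
    ∃ θ η, IsTestField U θ ∧ IsTestField U η ∧
      tsupport θ ⊆ tsupport φ ∪ tsupport ψ ∧ tsupport η ⊆ tsupport φ ∪ tsupport ψ ∧
      (∫ x, (u x + v x - smoothAbs δ (u x - v x)) / 2 * vecDiv φ x) +
        ∫ x, (u x + v x + smoothAbs δ (u x - v x)) / 2 * vecDiv ψ x =
      (∫ x, u x * vecDiv θ x) + ∫ x, v x * vecDiv η x := by
  let s : EuclideanSpace ℝ (Fin n) → ℝ := fun x => (u x - v x) / smoothAbs δ (u x - v x)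
  have hw : ContDiff ℝ 1 fun x => smoothAbs δ (u x - v x) :=
    (contDiff_smoothAbs hδ).comp (hu.sub hv)
  have hs : ContDiff ℝ 1 s := (hu.sub hv).div hw fun x => (smoothAbs_pos hδ _).ne'
  have hs1 (x) : |s x| ≤ 1 := by
    rw [abs_div, abs_of_pos (smoothAbs_pos hδ _), div_le_one (smoothAbs_pos hδ _)]
    exact abs_le_smoothAbs _ _
  have ha : ContDiff ℝ 1 fun x => (1 - s x) / 2 := (contDiff_const.sub hs).div_const 2
  have hb : ContDiff ℝ 1 fun x => (1 + s x) / 2 := (contDiff_const.add hs).div_const 2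
  have ha0 (x) : 0 ≤ (1 - s x) / 2 := by linarith [(abs_le.1 (hs1 x)).2]
  have hb0 (x) : 0 ≤ (1 + s x) / 2 := by linarith [(abs_le.1 (hs1 x)).1]
  have hθ := hφ.convexComb hψ ha hb ha0 hb0 fun x => by ring
  have hη := hφ.convexComb hψ hb ha hb0 ha0 fun x => by ring
  have hm : ContDiff ℝ 1 fun x => (u x + v x - smoothAbs δ (u x - v x)) / 2 :=
    ((hu.add hv).sub hw).div_const 2
  have hM : ContDiff ℝ 1 fun x => (u x + v x + smoothAbs δ (u x - v x)) / 2 :=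
    ((hu.add hv).add hw).div_const 2
  refine ⟨_, _, hθ, hη, tsupport_smul_add_smul_subset _ _, tsupport_smul_add_smul_subset _ _, ?_⟩
  rw [integral_mul_vecDiv hm hφ.contDiff hφ.compact, integral_mul_vecDiv hM hψ.contDiff hψ.compact,
    integral_mul_vecDiv hu hθ.contDiff hθ.compact, integral_mul_vecDiv hv hη.contDiff hη.compact,
    ← neg_add, ← neg_add,
    ← integral_add (integrable_fderiv_apply hm hφ) (integrable_fderiv_apply hM hψ),
    ← integral_add (integrable_fderiv_apply hu hθ) (integrable_fderiv_apply hv hη)]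
  congr 1
  refine integral_congr_ae (Eventually.of_forall fun x => ?_)
  have hdu := (hu.differentiable one_ne_zero x).hasFDerivAt
  have hdv := (hv.differentiable one_ne_zero x).hasFDerivAt
  have hdw : HasFDerivAt (fun x => smoothAbs δ (u x - v x)) (s x • (fderiv ℝ u x - fderiv ℝ v x))
      x := HasDerivAt.comp_hasFDerivAt (h₂ := smoothAbs δ) (f := fun x => u x - v x) x
    (hasDerivAt_smoothAbs hδ (u x - v x)) (hdu.sub hdv)
  have h1 : HasFDerivAt (fun x => (u x + v x - smoothAbs δ (u x - v x)) / 2) _ x :=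
    (((hdu.add hdv).sub hdw).mul_const (2 : ℝ)⁻¹)
  have h2 : HasFDerivAt (fun x => (u x + v x + smoothAbs δ (u x - v x)) / 2) _ x :=
    (((hdu.add hdv).add hdw).mul_const (2 : ℝ)⁻¹)
  simp only [h1.fderiv, h2.fderiv, smul_apply, add_apply, sub_apply, map_add, map_smul, smul_eq_mul]
  ring

/-- The submodularity of the perimeter, tested against fixed vector fields. -/
lemma integral_inter_add_integral_union_le (hU : IsOpen U) (hE : MeasurableSet E)
    (hF : MeasurableSet F) (hPE : perim n E U ≠ ⊤) (hPF : perim n F U ≠ ⊤)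
    (hφ : IsTestField U φ) (hψ : IsTestField U ψ) :
    (∫ x in E ∩ F, vecDiv φ x) + ∫ x in E ∪ F, vecDiv ψ x ≤
      (perim n E U).toReal + (perim n F U).toReal := by
  obtain ⟨r, hr0, hr⟩ := (hφ.compact.isCompact.union hψ.compact.isCompact
    ).exists_cthickening_subset_open hU (union_subset hφ.tsupport_subset hψ.tsupport_subset)
  let δ : ℕ → ℝ := fun k => 1 / ((k : ℝ) + 1)
  have hδ0 (k) : 0 < δ k := Nat.one_div_pos_of_nat
  have hδ1 (k) : δ k ≤ 1 := by
    rw [div_le_one (by positivity)]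
    linarith [(Nat.cast_nonneg k : (0 : ℝ) ≤ k)]
  have hδ : Tendsto δ atTop (𝓝 0) := tendsto_one_div_add_atTop_nhds_zero_nat
  let ρ : ℕ → ContDiffBump (0 : EuclideanSpace ℝ (Fin n)) := fun k =>
    ⟨r * δ k / 2, r * δ k, half_pos (mul_pos hr0 (hδ0 k)), half_lt_self (mul_pos hr0 (hδ0 k))⟩
  have hρ : Tendsto (fun k => (ρ k).rOut) atTop (𝓝 0) := by simpa using hδ.const_mul r
  have hρr (k) : (ρ k).rOut ≤ r := mul_le_of_le_one_right hr0.le (hδ1 k)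
  have hconv {G : Set (EuclideanSpace ℝ (Fin n))} (hG : MeasurableSet G) :
      ∀ᵐ x, Tendsto (fun k => mollify (ρ k) G x) atTop
        (𝓝 (G.indicator (fun _ => (1 : ℝ)) x)) :=
    ContDiffBump.ae_convolution_tendsto_right_of_locallyIntegrable (K := 2) hρ
      (Eventually.of_forall fun k => by simp only [ρ]; linarith)
      (locallyIntegrable_indicator_one hG)
  let w : ℕ → EuclideanSpace ℝ (Fin n) → ℝ := fun k x =>
    smoothAbs (δ k) (mollify (ρ k) E x - mollify (ρ k) F x)
  have hw0 (k x) : 0 ≤ w k x := (smoothAbs_pos (hδ0 k) _).le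
  have hw2 (k x) : w k x ≤ 2 := by
    have hE := mollify_mem_Icc (E := E) (ρ k) x
    have hF := mollify_mem_Icc (E := F) (ρ k) x
    have := abs_le.2 (⟨by linarith [hE.1, hF.2], by linarith [hE.2, hF.1]⟩ :
      -1 ≤ mollify (ρ k) E x - mollify (ρ k) F x ∧ mollify (ρ k) E x - mollify (ρ k) F x ≤ 1)
    have := smoothAbs_le (hδ0 k).le (mollify (ρ k) E x - mollify (ρ k) F x)
    linarith [hδ1 k]
  have hwlim : ∀ᵐ x, Tendsto (fun k => w k x) atTop
      (𝓝 |E.indicator (fun _ => (1 : ℝ)) x - F.indicator (fun _ => (1 : ℝ)) x|) := by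
    filter_upwards [hconv hE, hconv hF] with x h1 h2
    have := ((((h1.sub h2).pow 2).add (hδ.pow 2))).sqrt
    simpa [w, smoothAbs, Real.sqrt_sq_eq_abs] using this
  have hbound (k x) : |(mollify (ρ k) E x + mollify (ρ k) F x - w k x) / 2| ≤ 2 ∧
      |(mollify (ρ k) E x + mollify (ρ k) F x + w k x) / 2| ≤ 2 := by
    have hE := mollify_mem_Icc (E := E) (ρ k) x
    have hF := mollify_mem_Icc (E := F) (ρ k) x
    constructor <;> rw [abs_le] <;> constructor <;>
      linarith [hE.1, hE.2, hF.1, hF.2, hw0 k x, hw2 k x]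
  have hmc (k) (G : Set (EuclideanSpace ℝ (Fin n))) (hG : MeasurableSet G) :
      Continuous (mollify (ρ k) G) := (contDiff_mollify (ρ k) hG).continuous
  have hwc (k) : Continuous (w k) :=
    (contDiff_smoothAbs (hδ0 k)).continuous.comp ((hmc k E hE).sub (hmc k F hF))
  have hlim1 : Tendsto (fun k => ∫ x, (mollify (ρ k) E x + mollify (ρ k) F x - w k x) / 2 *
      vecDiv φ x) atTop (𝓝 (∫ x in E ∩ F, vecDiv φ x)) := by
    rw [← integral_indicator (hE.inter hF)]
    refine tendsto_integral_of_dominated_convergence (fun x => 2 * |vecDiv φ x|) (fun k => ?_)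
      (hφ.integrable_vecDiv.abs.const_mul 2) (fun k => Eventually.of_forall fun x => ?_) ?_
    · exact ((((hmc k E hE).add (hmc k F hF)).sub (hwc k)).div_const 2 |>.mul
        (continuous_vecDiv hφ.contDiff)).aestronglyMeasurable
    · rw [Real.norm_eq_abs, abs_mul]
      exact mul_le_mul_of_nonneg_right (hbound k x).1 (abs_nonneg _)
    · filter_upwards [hconv hE, hconv hF, hwlim] with x h1 h2 h3
      have := (((h1.add h2).sub h3).div_const 2).mul_const (vecDiv φ x)
      convert this using 2
      by_cases hxE : x ∈ E <;> by_cases hxF : x ∈ F <;> simp [hxE, hxF]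
  have hlim2 : Tendsto (fun k => ∫ x, (mollify (ρ k) E x + mollify (ρ k) F x + w k x) / 2 *
      vecDiv ψ x) atTop (𝓝 (∫ x in E ∪ F, vecDiv ψ x)) := by
    rw [← integral_indicator (hE.union hF)]
    refine tendsto_integral_of_dominated_convergence (fun x => 2 * |vecDiv ψ x|) (fun k => ?_)
      (hψ.integrable_vecDiv.abs.const_mul 2) (fun k => Eventually.of_forall fun x => ?_) ?_
    · exact ((((hmc k E hE).add (hmc k F hF)).add (hwc k)).div_const 2 |>.mul
        (continuous_vecDiv hψ.contDiff)).aestronglyMeasurable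
    · rw [Real.norm_eq_abs, abs_mul]
      exact mul_le_mul_of_nonneg_right (hbound k x).2 (abs_nonneg _)
    · filter_upwards [hconv hE, hconv hF, hwlim] with x h1 h2 h3
      have := (((h1.add h2).add h3).div_const 2).mul_const (vecDiv ψ x)
      convert this using 2
      by_cases hxE : x ∈ E <;> by_cases hxF : x ∈ F <;> simp [hxE, hxF]
  refine le_of_tendsto (hlim1.add hlim2) (Eventually.of_forall fun k => ?_)
  obtain ⟨θ, η, hθ, hη, hθs, hηs, heq⟩ := exists_testField_smooth_min_max
    (contDiff_mollify (ρ k) hE) (contDiff_mollify (ρ k) hF) hφ hψ (hδ0 k)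
  refine heq.trans_le (add_le_add ?_ ?_)
  · exact integral_mollify_mul_vecDiv_le (ρ k) hE hPE hθ
      (((cthickening_mono (hρr k) _).trans (cthickening_subset_of_subset r hθs)).trans hr)
  · exact integral_mollify_mul_vecDiv_le (ρ k) hF hPF hη
      (((cthickening_mono (hρr k) _).trans (cthickening_subset_of_subset r hηs)).trans hr)

/-- Submodularity of the perimeter. -/
lemma perim_inter_add_perim_union_le (hU : IsOpen U) (hE : MeasurableSet E)
    (hF : MeasurableSet F) (hPE : perim n E U ≠ ⊤) (hPF : perim n F U ≠ ⊤) :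
    perim n (E ∩ F) U ≠ ⊤ ∧ perim n (E ∪ F) U ≠ ⊤ ∧
      (perim n (E ∩ F) U).toReal + (perim n (E ∪ F) U).toReal ≤
        (perim n E U).toReal + (perim n F U).toReal := by
  have key {ψ} (hψ : IsTestField U ψ) := perim_le_ofReal (E := E ∩ F) (U := U)
    (c := (perim n E U).toReal + (perim n F U).toReal - ∫ x in E ∪ F, vecDiv ψ x) fun φ hφ =>
      le_sub_iff_add_le.2 (integral_inter_add_integral_union_le hU hE hF hPE hPF hφ hψ)
  have key2 := perim_le_ofReal (E := E ∪ F) (U := U)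
    (c := (perim n E U).toReal + (perim n F U).toReal - (perim n (E ∩ F) U).toReal) fun ψ hψ => by
      linarith [(key hψ).2]
  exact ⟨(key isTestField_zero).1, key2.1, by linarith [key2.2]⟩

end Submodularity

section MassariFunctional

variable {n : ℕ} {U E F : Set (EuclideanSpace ℝ (Fin n))} {H : EuclideanSpace ℝ (Fin n) → ℝ}

lemma massariF_eq_coe (hE : perim n E U ≠ ⊤) :
    massariF n H U E = (((perim n E U).toReal - ∫ x in E ∩ U, H x : ℝ) : EReal) := by
  rw [massariF, EReal.coe_sub, EReal.coe_ennreal_toReal hE]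

lemma massariF_eq_top (hE : perim n E U = ⊤) : massariF n H U E = ⊤ := by
  rw [massariF, hE, EReal.coe_ennreal_top, EReal.top_sub_coe]

lemma IsLocVMC.toReal_le (h : IsLocVMC n H E U) (hE : perim n E U ≠ ⊤) (hF : perim n F U ≠ ⊤)
    (hFm : MeasurableSet F) (hc : IsCompact (closure (F ∆ E))) (hs : closure (F ∆ E) ⊆ U) :
    (perim n E U).toReal - ∫ x in E ∩ U, H x ≤ (perim n F U).toReal - ∫ x in F ∩ U, H x := by
  have := h F hFm hc hs
  rwa [massariF_eq_coe hE, massariF_eq_coe hF, EReal.coe_le_coe_iff] at this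

end MassariFunctional

/-- if `H₁, H₂ ∈ L¹(U)` are both local variational mean curvatures of `E`
in `U`, then so is `Ĥ = H₁ 1_{E∩U} + H₂ 1_{U∖E}`. -/
theorem stmt10 (n : ℕ) (hn : 2 ≤ n) (U : Set (EuclideanSpace ℝ (Fin n))) (hU : IsOpen U)
    (E : Set (EuclideanSpace ℝ (Fin n))) (hEm : MeasurableSet E)
    (hEper : perim n E U < ⊤)
    (H₁ H₂ : EuclideanSpace ℝ (Fin n) → ℝ)
    (hH₁int : IntegrableOn H₁ U) (hH₂int : IntegrableOn H₂ U)
    (hH₁ : IsLocVMC n H₁ E U) (hH₂ : IsLocVMC n H₂ E U) :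
    IsLocVMC n
      (fun x => Set.indicator (E ∩ U) H₁ x + Set.indicator (U \ E) H₂ x) E U := by
  intro F hF hc hs
  by_cases hPF : perim n F U = ⊤
  · rw [massariF_eq_top hPF]
    exact le_top
  have hPE := hEper.ne
  obtain ⟨hPi, hPu, hsub⟩ := perim_inter_add_perim_union_le hU hEm hF hPE hPF
  rw [massariF_eq_coe hPE, massariF_eq_coe hPF, EReal.coe_le_coe_iff]
  have hUm := hU.measurableSet
  have hsub_inter : closure ((E ∩ F) ∆ E) ⊆ closure (F ∆ E) := by
    refine closure_mono fun x hx => ?_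
    simp only [mem_symmDiff, mem_inter_iff] at hx ⊢
    tauto
  have hsub_union : closure ((E ∪ F) ∆ E) ⊆ closure (F ∆ E) := by
    refine closure_mono fun x hx => ?_
    simp only [mem_symmDiff, mem_union] at hx ⊢
    tauto
  have h1 := hH₁.toReal_le hPE hPi (hEm.inter hF)
    (hc.of_isClosed_subset isClosed_closure hsub_inter) (hsub_inter.trans hs)
  have h2 := hH₂.toReal_le hPE hPu (hEm.union hF)
    (hc.of_isClosed_subset isClosed_closure hsub_union) (hsub_union.trans hs)
  have hi1 : Integrable ((E ∩ U).indicator H₁) :=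
    (hH₁int.mono_set inter_subset_right).integrable_indicator (hEm.inter hUm)
  have hi2 : Integrable ((U \ E).indicator H₂) :=
    (hH₂int.mono_set sdiff_subset).integrable_indicator (hUm.diff hEm)
  have hsplit (G : Set (EuclideanSpace ℝ (Fin n))) :
      ∫ x in G ∩ U, ((E ∩ U).indicator H₁ x + (U \ E).indicator H₂ x) =
        (∫ x in G ∩ U ∩ (E ∩ U), H₁ x) + ∫ x in G ∩ U ∩ (U \ E), H₂ x := by
    rw [integral_add hi1.integrableOn hi2.integrableOn, setIntegral_indicator (hEm.inter hUm),
      setIntegral_indicator (hUm.diff hEm)]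
  have hunion : ∫ x in (E ∪ F) ∩ U, H₂ x =
      (∫ x in E ∩ U, H₂ x) + ∫ x in F ∩ U ∩ (U \ E), H₂ x := by
    rw [← setIntegral_union _ ((hF.inter hUm).inter (hUm.diff hEm))
      (hH₂int.mono_set inter_subset_right)
      (hH₂int.mono_set (inter_subset_left.trans inter_subset_right))]
    · congr 2
      ext x
      simp only [mem_inter_iff, mem_union, Set.mem_sdiff]
      tauto
    · rw [Set.disjoint_left]
      exact fun x hx hx' => hx'.2.2 hx.1
  have hsE1 : E ∩ U ∩ (E ∩ U) = E ∩ U := inter_self _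
  have hsE2 : E ∩ U ∩ (U \ E) = ∅ := by
    ext x
    simp only [mem_inter_iff, Set.mem_sdiff, mem_empty_iff_false]
    tauto
  have hsF1 : F ∩ U ∩ (E ∩ U) = E ∩ F ∩ U := by
    ext x
    simp only [mem_inter_iff]
    tauto
  rw [hsplit, hsplit, hsE1, hsE2, hsF1, setIntegral_empty]
  linarith
end

section
/- Let r > 0 and let B_r(x) ⊆ ℝ^n be an open ball. Then for every measurable G ⊆ B_r(x) of finite perimeter, P(B_r(x)) ≤ P(G) + (n/r)|B_r(x) ∖ G|; that is, B_r(x) minimizes F(G) = P(G) - (n/r)|G| among its measurable subsets. -/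
open MeasureTheory Metric Set
open scoped ENNReal

/-- The divergence `∑ ∂ᵢ φᵢ` of a vector field on Euclidean space. -/
noncomputable def divergence {n : ℕ}
    (φ : EuclideanSpace ℝ (Fin n) → EuclideanSpace ℝ (Fin n))
    (y : EuclideanSpace ℝ (Fin n)) : ℝ :=
  ∑ i, fderiv ℝ φ y (EuclideanSpace.single i 1) i

lemma continuous_divergence {n : ℕ}
    {φ : EuclideanSpace ℝ (Fin n) → EuclideanSpace ℝ (Fin n)} (hφ : ContDiff ℝ 1 φ) :
    Continuous (divergence φ) := by
  have := hφ.continuous_fderiv one_ne_zero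
  unfold divergence
  fun_prop

lemma hasCompactSupport_divergence {n : ℕ}
    {φ : EuclideanSpace ℝ (Fin n) → EuclideanSpace ℝ (Fin n)} (hc : HasCompactSupport φ) :
    HasCompactSupport (divergence φ) := by
  refine (hc.fderiv (𝕜 := ℝ)).comp_left
    (g := fun L : EuclideanSpace ℝ (Fin n) →L[ℝ] EuclideanSpace ℝ (Fin n) =>
      ∑ i, L (EuclideanSpace.single i 1) i) ?_
  simp

/-- Integration by parts of a Lipschitz function against the divergence of a vector field. -/
lemma LipschitzWith.integral_mul_divergence {n : ℕ} {C : NNReal}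
    {η : EuclideanSpace ℝ (Fin n) → ℝ} (hη : LipschitzWith C η)
    {φ : EuclideanSpace ℝ (Fin n) → EuclideanSpace ℝ (Fin n)} (hφ : ContDiff ℝ 1 φ)
    (hc : HasCompactSupport φ) :
    ∫ y, η y * divergence φ y = -∫ y, fderiv ℝ η y (φ y) := by
  have hφi (i : Fin n) : ContDiff ℝ 1 (fun y => φ y i) := contDiff_euclidean.1 hφ i
  have hci (i : Fin n) : HasCompactSupport (fun y => φ y i) :=
    hc.comp_left (g := fun v : EuclideanSpace ℝ (Fin n) => v i) (by simp)
  have hparts (i : Fin n) :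
      ∫ y, η y * fderiv ℝ φ y (EuclideanSpace.single i 1) i =
        -∫ y, lineDeriv ℝ η y (EuclideanSpace.single i 1) * φ y i := by
    obtain ⟨D, hD⟩ := (hφi i).lipschitzWith_of_hasCompactSupport (hci i) one_ne_zero
    rw [hη.integral_lineDeriv_mul_eq hD (hci i), ← integral_neg]
    congr 1 with y
    have h1 : HasFDerivAt (fun y => φ y i)
        ((EuclideanSpace.proj i).comp (fderiv ℝ φ y) : EuclideanSpace ℝ (Fin n) →L[ℝ] ℝ) y :=
      (EuclideanSpace.proj (𝕜 := ℝ) i).hasFDerivAt.comp y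
        (hφ.differentiable one_ne_zero y).hasFDerivAt
    rw [(h1.hasLineDerivAt _).lineDeriv]
    simp [mul_comm]
  have hint₁ (i : Fin n) :
      Integrable fun y => η y * fderiv ℝ φ y (EuclideanSpace.single i 1) i := by
    have h1 := hφ.continuous_fderiv one_ne_zero
    have h2 := hη.continuous
    refine Continuous.integrable_of_hasCompactSupport (by fun_prop) ?_
    refine HasCompactSupport.mul_left ?_
    exact (hc.fderiv (𝕜 := ℝ)).comp_left
      (g := fun L : EuclideanSpace ℝ (Fin n) →L[ℝ] EuclideanSpace ℝ (Fin n) =>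
        L (EuclideanSpace.single i 1) i) (by simp)
  have hint₂ (i : Fin n) :
      Integrable fun y => lineDeriv ℝ η y (EuclideanSpace.single i 1) * φ y i :=
    ((hφi i).continuous.integrable_of_hasCompactSupport (hci i)).bdd_mul
      (aestronglyMeasurable_lineDeriv hη.continuous _)
      (.of_forall fun y => norm_lineDeriv_le_of_lipschitz ℝ hη)
  have hae : (fun y => fderiv ℝ η y (φ y)) =ᵐ[volume]
      fun y => ∑ i, lineDeriv ℝ η y (EuclideanSpace.single i 1) * φ y i := by
    filter_upwards [hη.ae_differentiableAt] with y hy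
    conv_lhs => rw [← (EuclideanSpace.basisFun (Fin n) ℝ).sum_repr (φ y)]
    simp [hy.lineDeriv_eq_fderiv, mul_comm]
  rw [integral_congr_ae hae, integral_finsetSum _ fun i _ => hint₂ i]
  simp_rw [divergence, Finset.mul_sum]
  rw [integral_finsetSum _ fun i _ => hint₁ i, ← Finset.sum_neg_distrib]
  exact Finset.sum_congr rfl fun i _ => hparts i

/-- The Lipschitz function equal to `1` on `ball x (r - ε)`, vanishing outside `ball x r` and
affine in the distance to `x` in between. -/
noncomputable def radialCutoff {E : Type*} [PseudoMetricSpace E] (x : E) (r ε : ℝ) (y : E) : ℝ :=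
  max 0 (min 1 ((r - dist y x) / ε))

section radialCutoff

variable {E : Type*} [PseudoMetricSpace E] {x y : E} {r ε : ℝ}

lemma radialCutoff_of_mem_ball (hε : 0 < ε) (hy : y ∈ ball x (r - ε)) :
    radialCutoff x r ε y = 1 := by
  rw [mem_ball] at hy
  have : 1 ≤ (r - dist y x) / ε := by rw [le_div_iff₀ hε]; linarith
  simp [radialCutoff, this]

lemma radialCutoff_of_notMem_ball (hε : 0 < ε) (hy : y ∉ ball x r) :
    radialCutoff x r ε y = 0 := by
  rw [mem_ball, not_lt] at hy
  have : (r - dist y x) / ε ≤ 0 := div_nonpos_of_nonpos_of_nonneg (by linarith) hε.le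
  simp [radialCutoff, this]

lemma radialCutoff_mem_Icc : radialCutoff x r ε y ∈ Icc (0 : ℝ) 1 := by
  simp [radialCutoff]

lemma lipschitzWith_radialCutoff (hε : 0 < ε) :
    LipschitzWith (Real.toNNReal ε⁻¹) (radialCutoff x r ε) := by
  refine LipschitzWith.const_max (LipschitzWith.const_min ?_ 1) 0
  refine LipschitzWith.of_dist_le_mul fun a b => ?_
  rw [Real.coe_toNNReal _ (inv_nonneg.2 hε.le), Real.dist_eq, ← sub_div, abs_div, abs_of_pos hε,
    div_eq_inv_mul]
  gcongr
  rw [sub_sub_sub_cancel_left, dist_comm a b]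
  exact abs_dist_sub_le _ _ _

end radialCutoff

/-- The volume of a thin shell, bounded through Bernoulli's inequality. -/
lemma volume_real_closedBall_diff_ball_le {n : ℕ} (x : EuclideanSpace ℝ (Fin n)) {r ε : ℝ}
    (hr : 0 < r) (hε : 0 < ε) (hεr : ε < r) :
    volume.real (closedBall x r \ ball x (r - ε)) ≤ n * (ε / r) * volume.real (ball x r) := by
  have hs : ball x (r - ε) ⊆ closedBall x r :=
    ball_subset_closedBall.trans (closedBall_subset_closedBall (by linarith))
  have hball (s : ℝ) (hs : 0 < s) :
      volume.real (ball x s) = s ^ n * volume.real (ball (0 : EuclideanSpace ℝ (Fin n)) 1) := by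
    rw [measureReal_def, Measure.addHaar_ball_of_pos _ _ hs, ENNReal.toReal_mul,
      ENNReal.toReal_ofReal (by positivity), finrank_euclideanSpace_fin, measureReal_def]
  rw [measureReal_sdiff hs measurableSet_ball measure_closedBall_lt_top.ne,
    Measure.addHaar_real_closedBall _ _ hr.le, hball _ hr, hball _ (sub_pos.2 hεr),
    finrank_euclideanSpace_fin, ← sub_mul, ← mul_assoc]
  gcongr
  have hb := one_add_mul_le_pow (a := -(ε / r)) (by
    have : ε / r < 1 := (div_lt_one hr).2 hεr
    linarith) n
  have : (r - ε) ^ n = r ^ n * (1 + -(ε / r)) ^ n := by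
    rw [← mul_pow]
    congr 1
    field_simp
    ring
  rw [this]
  nlinarith [pow_pos hr n]

lemma abs_integral_le_mul_measureReal {α : Type*} [MeasurableSpace α] {μ : Measure α}
    {A : Set α} (hfin : μ A ≠ ⊤) {f : α → ℝ} {M : ℝ}
    (hM : ∀ y ∈ A, |f y| ≤ M) (h0 : ∀ y ∉ A, f y = 0) :
    |∫ y, f y ∂μ| ≤ M * μ.real A := by
  rw [← setIntegral_eq_integral_of_forall_compl_eq_zero h0]
  exact norm_setIntegral_le_of_norm_le_const (f := f) hfin.lt_top hM

/-- The flux through a sphere of a field of norm at most one is at most the area of the sphere. -/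
lemma setIntegral_ball_divergence_le {n : ℕ} (x : EuclideanSpace ℝ (Fin n)) {r : ℝ} (hr : 0 < r)
    {φ : EuclideanSpace ℝ (Fin n) → EuclideanSpace ℝ (Fin n)} (hφ : ContDiff ℝ 1 φ)
    (hc : HasCompactSupport φ) (hφ1 : ∀ y, ‖φ y‖ ≤ 1) :
    ∫ y in ball x r, divergence φ y ≤ n / r * volume.real (ball x r) := by
  have hdc := continuous_divergence hφ
  have hds := hasCompactSupport_divergence hc
  obtain ⟨C, hC⟩ := hds.exists_bound_of_continuous hdc
  have hC0 : 0 ≤ C := (norm_nonneg _).trans (hC 0)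
  set V := volume.real (ball x r)
  have hbound (ε : ℝ) (hε : 0 < ε) (hεr : ε < r) :
      ∫ y in ball x r, divergence φ y ≤ n / r * V + C * (n * (ε / r) * V) := by
    set A := closedBall x r \ ball x (r - ε)
    have hAfin : volume A ≠ ⊤ :=
      ((measure_mono sdiff_subset).trans_lt measure_closedBall_lt_top).ne
    have hAV : volume.real A ≤ n * (ε / r) * V :=
      volume_real_closedBall_diff_ball_le x hr hε hεr
    have hη := lipschitzWith_radialCutoff (x := x) (r := r) hε
    set η := radialCutoff x r ε
    have hint : Integrable fun y => η y * divergence φ y :=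
      (hη.continuous.mul hdc).integrable_of_hasCompactSupport hds.mul_left
    have hsplit : ∫ y in ball x r, divergence φ y =
        (∫ y, η y * divergence φ y) +
          ∫ y, ((ball x r).indicator (divergence φ) y - η y * divergence φ y) := by
      rw [integral_sub ((hdc.integrable_of_hasCompactSupport hds).indicator measurableSet_ball)
        hint, integral_indicator measurableSet_ball]
      ring
    have hflux : |∫ y, fderiv ℝ η y (φ y)| ≤ ε⁻¹ * volume.real A := by
      refine abs_integral_le_mul_measureReal hAfin (fun y _ => ?_) fun y hy => ?_
      · calc |fderiv ℝ η y (φ y)| ≤ ‖fderiv ℝ η y‖ * ‖φ y‖ := (fderiv ℝ η y).le_opNorm _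
          _ ≤ ε⁻¹ * 1 := by
            gcongr
            · simpa [hε.le] using norm_fderiv_le_of_lipschitz ℝ hη (x₀ := y)
            · exact hφ1 y
          _ = ε⁻¹ := mul_one _
      · have : fderiv ℝ η y = 0 := by
          by_cases hyr : y ∈ ball x (r - ε)
          · have : η =ᶠ[nhds y] fun _ => (1 : ℝ) := by
              filter_upwards [isOpen_ball.mem_nhds hyr] with z hz
              exact radialCutoff_of_mem_ball hε hz
            rw [this.fderiv_eq, fderiv_fun_const]
            rfl
          · have hy' : y ∈ (closedBall x r)ᶜ := fun h => hy ⟨h, hyr⟩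
            have : η =ᶠ[nhds y] fun _ => (0 : ℝ) := by
              filter_upwards [isClosed_closedBall.isOpen_compl.mem_nhds hy'] with z hz
              exact radialCutoff_of_notMem_ball hε fun h => hz (ball_subset_closedBall h)
            rw [this.fderiv_eq, fderiv_fun_const]
            rfl
        simp [this]
    have herr : |∫ y, ((ball x r).indicator (divergence φ) y - η y * divergence φ y)| ≤
        C * volume.real A := by
      refine abs_integral_le_mul_measureReal hAfin (fun y _ => ?_) fun y hy => ?_
      · have hηy : η y ∈ Icc (0 : ℝ) 1 := radialCutoff_mem_Icc
        by_cases hyr : y ∈ ball x r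
        · rw [indicator_of_mem hyr, ← one_sub_mul, abs_mul, abs_of_nonneg (sub_nonneg.2 hηy.2)]
          exact (mul_le_of_le_one_left (abs_nonneg _) (by linarith [hηy.1])).trans (hC y)
        · rw [indicator_of_notMem hyr]
          simp [η, radialCutoff_of_notMem_ball hε hyr, hC0]
      · by_cases hyr : y ∈ ball x (r - ε)
        · have : y ∈ ball x r := ball_subset_ball (by linarith) hyr
          simp [η, indicator_of_mem this, radialCutoff_of_mem_ball hε hyr]
        · have : y ∉ ball x r := fun h => hy ⟨ball_subset_closedBall h, hyr⟩
          simp [η, indicator_of_notMem this, radialCutoff_of_notMem_ball hε this]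
    rw [hsplit, hη.integral_mul_divergence hφ hc]
    have h1 : ε⁻¹ * volume.real A ≤ n / r * V := by
      calc ε⁻¹ * volume.real A ≤ ε⁻¹ * (n * (ε / r) * V) := by gcongr
        _ = n / r * V := by field_simp
    have h2 : C * volume.real A ≤ C * (n * (ε / r) * V) := by gcongr
    linarith [neg_le_abs (∫ y, fderiv ℝ η y (φ y)), le_abs_self
      (∫ y, ((ball x r).indicator (divergence φ) y - η y * divergence φ y))]
  have hlim : Filter.Tendsto (fun ε : ℝ => n / r * V + C * (n * (ε / r) * V))
      (nhdsWithin 0 (Ioi 0)) (nhds (n / r * V)) := by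
    have : Continuous fun ε : ℝ => n / r * V + C * (n * (ε / r) * V) := by fun_prop
    simpa using (this.tendsto 0).mono_left nhdsWithin_le_nhds
  refine ge_of_tendsto hlim ?_
  filter_upwards [Ioo_mem_nhdsGT hr] with ε hε using hbound ε hε.1 hε.2

lemma perim_ball_le {n : ℕ} (x : EuclideanSpace ℝ (Fin n)) {r : ℝ} (hr : 0 < r)
    (U : Set (EuclideanSpace ℝ (Fin n))) :
    perim n (ball x r) U ≤ ENNReal.ofReal (n / r) * volume (ball x r) := by
  refine iSup_le fun φ => iSup_le fun hφ => iSup_le fun hc => iSup_le fun _ => iSup_le fun h1 => ?_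
  rw [← ofReal_measureReal measure_ball_lt_top.ne, ← ENNReal.ofReal_mul (by positivity)]
  exact ENNReal.ofReal_le_ofReal (setIntegral_ball_divergence_le x hr hφ hc h1)

/-- Testing the perimeter with a truncation of the radial field `(y - x) / R`. -/
lemma ofReal_div_mul_volume_le_perim_of_lt {n : ℕ} {x : EuclideanSpace ℝ (Fin n)} {r R : ℝ}
    (hr : 0 < r) (hR : r < R) {G : Set (EuclideanSpace ℝ (Fin n))} (hGm : MeasurableSet G)
    (hG : G ⊆ ball x r) :
    ENNReal.ofReal (n / R) * volume G ≤ perim n G univ := by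
  have hR0 : 0 < R := hr.trans hR
  let f : ContDiffBump x := ⟨r, R, hr, hR⟩
  let φ : EuclideanSpace ℝ (Fin n) → EuclideanSpace ℝ (Fin n) := fun y => f y • R⁻¹ • (y - x)
  have hφ : ContDiff ℝ 1 φ :=
    f.contDiff.smul ((contDiff_id.sub contDiff_const).const_smul R⁻¹)
  have hc : HasCompactSupport φ := f.hasCompactSupport.smul_right
  have h1 (y) : ‖φ y‖ ≤ 1 := by
    by_cases hy : R ≤ dist y x
    · simp [φ, f.zero_of_le_dist hy]
    · rw [norm_smul, norm_smul, Real.norm_of_nonneg f.nonneg, Real.norm_of_nonneg (by positivity),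
        ← dist_eq_norm, ← div_eq_inv_mul]
      exact mul_le_one₀ f.le_one (by positivity) ((div_le_one hR0).2 (not_le.1 hy).le)
  have hdiv : ∀ y ∈ G, divergence φ y = n / R := by
    intro y hy
    have heq : φ =ᶠ[nhds y] fun y => R⁻¹ • (y - x) := by
      filter_upwards [f.eventuallyEq_one_of_mem_ball (hG hy)] with z hz
      simp [φ, hz]
    have hd : HasFDerivAt (fun y => R⁻¹ • (y - x))
        (R⁻¹ • ContinuousLinearMap.id ℝ (EuclideanSpace ℝ (Fin n))) y :=
      ((hasFDerivAt_id y).sub_const x).const_smul R⁻¹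
    simp [divergence, heq.fderiv_eq, hd.fderiv, div_eq_mul_inv]
  have hfin : volume G ≠ ⊤ := ((measure_mono hG).trans_lt measure_ball_lt_top).ne
  have hval : ENNReal.ofReal (n / R) * volume G =
      ENNReal.ofReal (∫ y in G, ∑ i, fderiv ℝ φ y (EuclideanSpace.single i 1) i) := by
    have : ∫ y in G, divergence φ y = n / R * volume.real G := by
      rw [setIntegral_congr_fun hGm hdiv, setIntegral_const, smul_eq_mul, mul_comm]
    change _ = ENNReal.ofReal (∫ y in G, divergence φ y)
    rw [this, ENNReal.ofReal_mul (by positivity), ofReal_measureReal hfin]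
  rw [hval]
  exact le_iSup_of_le φ <| le_iSup_of_le hφ <| le_iSup_of_le hc <|
    le_iSup_of_le (subset_univ _) <| le_iSup_of_le h1 le_rfl

lemma ofReal_div_mul_volume_le_perim {n : ℕ} {x : EuclideanSpace ℝ (Fin n)} {r : ℝ}
    (hr : 0 < r) {G : Set (EuclideanSpace ℝ (Fin n))} (hGm : MeasurableSet G)
    (hG : G ⊆ ball x r) :
    ENNReal.ofReal (n / r) * volume G ≤ perim n G univ := by
  have hfin : volume G ≠ ⊤ := ((measure_mono hG).trans_lt measure_ball_lt_top).ne
  have hlim : Filter.Tendsto (fun R : ℝ => ENNReal.ofReal (n / R) * volume G)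
      (nhdsWithin r (Ioi r)) (nhds (ENNReal.ofReal (n / r) * volume G)) := by
    refine ENNReal.Tendsto.mul_const (ENNReal.tendsto_ofReal ?_) (.inr hfin)
    exact (tendsto_const_nhds.div Filter.tendsto_id hr.ne').mono_left nhdsWithin_le_nhds
  refine le_of_tendsto hlim ?_
  filter_upwards [self_mem_nhdsWithin] with R hR
    using ofReal_div_mul_volume_le_perim_of_lt hr hR hGm hG

/-- the ball `B_r(x)` minimizes `P(G) - (n/r)|G|` among its measurable
subsets of finite perimeter: `P(B_r(x)) ≤ P(G) + (n/r)|B_r(x) ∖ G|`. -/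
theorem stmt12 (n : ℕ) (hn : 2 ≤ n) (x : EuclideanSpace ℝ (Fin n)) (r : ℝ) (hr : 0 < r)
    (G : Set (EuclideanSpace ℝ (Fin n))) (hGm : MeasurableSet G) (hG : G ⊆ ball x r)
    (hGper : perim n G Set.univ < ⊤) :
    perim n (ball x r) Set.univ ≤
      perim n G Set.univ + ENNReal.ofReal ((n : ℝ) / r) * volume (ball x r \ G) := by
  calc perim n (ball x r) univ ≤ ENNReal.ofReal (n / r) * volume (ball x r) := perim_ball_le x hr _
    _ = ENNReal.ofReal (n / r) * volume G + ENNReal.ofReal (n / r) * volume (ball x r \ G) := by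
      rw [← mul_add, measure_add_sdiff hGm.nullMeasurableSet, union_eq_self_of_subset_left hG]
    _ ≤ _ := by
      gcongr
      exact ofReal_div_mul_volume_le_perim hr hGm hG
end

section
/- Let n = 3, s ∈ (0,1), and define f : B²₁(0) → ℝ by f(x,y) = (x²-y²)·sqrt(-log(sqrt(x²+y²))) for (x,y) ≠ 0 and f(0,0) = 0. Then f is of class C^{1,β} on B²_s(0) for every β ∈ (0,1), but f is not of class C^{1,1} on any neighborhood of the origin. -/
open Metric Set

/-- The function `f(x,y) = (x²-y²)√(-log √(x²+y²))`, with `f(0,0) = 0`. -/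
noncomputable def fEx (v : EuclideanSpace ℝ (Fin 2)) : ℝ :=
  ((v 0) ^ 2 - (v 1) ^ 2) * Real.sqrt (-Real.log (Real.sqrt ((v 0) ^ 2 + (v 1) ^ 2)))

/-- The radial profile `r ↦ √(-log r)`. -/
noncomputable def sqrtNegLog (r : ℝ) : ℝ := Real.sqrt (-Real.log r)

/-- The reflection `(x, y) ↦ (x, -y)`. -/
noncomputable def reflY (v : EuclideanSpace ℝ (Fin 2)) : EuclideanSpace ℝ (Fin 2) :=
  !₂[v 0, -v 1]

/-- The saddle `(x, y) ↦ x² - y²`. -/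
def saddle (v : EuclideanSpace ℝ (Fin 2)) : ℝ := (v 0) ^ 2 - (v 1) ^ 2

/-- The vector field `v ↦ (x² - y²) / |v|² • v`. -/
noncomputable def saddleField (v : EuclideanSpace ℝ (Fin 2)) : EuclideanSpace ℝ (Fin 2) :=
  (saddle v / ‖v‖ ^ 2) • v

/-- The gradient of `fEx` on the unit disc. -/
noncomputable def gradEx (v : EuclideanSpace ℝ (Fin 2)) : EuclideanSpace ℝ (Fin 2) :=
  (2 * sqrtNegLog ‖v‖) • reflY v - (2⁻¹ * (sqrtNegLog ‖v‖)⁻¹) • saddleField v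

lemma norm_sq_eq_coords (v : EuclideanSpace ℝ (Fin 2)) : ‖v‖ ^ 2 = v 0 ^ 2 + v 1 ^ 2 := by
  simp [EuclideanSpace.norm_sq_eq, Fin.sum_univ_two]

lemma fEx_eq (v : EuclideanSpace ℝ (Fin 2)) : fEx v = saddle v * sqrtNegLog ‖v‖ := by
  rw [fEx, saddle, sqrtNegLog, ← norm_sq_eq_coords, Real.sqrt_sq (norm_nonneg v)]

lemma norm_reflY (v : EuclideanSpace ℝ (Fin 2)) : ‖reflY v‖ = ‖v‖ := by
  have h : ‖reflY v‖ ^ 2 = ‖v‖ ^ 2 := by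
    rw [norm_sq_eq_coords, norm_sq_eq_coords]
    simp [reflY]
  exact (pow_left_inj₀ (norm_nonneg _) (norm_nonneg _) two_ne_zero).1 h

lemma reflY_sub (v w : EuclideanSpace ℝ (Fin 2)) : reflY v - reflY w = reflY (v - w) := by
  ext i
  fin_cases i
  · simp [reflY]
  · simp [reflY]; ring

lemma abs_saddle_le (v : EuclideanSpace ℝ (Fin 2)) : |saddle v| ≤ ‖v‖ ^ 2 := by
  rw [norm_sq_eq_coords, saddle, abs_le]
  constructor <;> nlinarith [sq_nonneg (v 0), sq_nonneg (v 1)]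

lemma abs_saddle_sub_le (v w : EuclideanSpace ℝ (Fin 2)) :
    |saddle v - saddle w| ≤ ‖v - w‖ * (‖v‖ + ‖w‖) := by
  have h : saddle v - saddle w = inner ℝ (reflY (v - w)) (v + w) := by
    simp [saddle, reflY, PiLp.inner_apply, Fin.sum_univ_two]
    ring
  rw [h]
  refine (abs_real_inner_le_norm _ _).trans ?_
  rw [norm_reflY]
  gcongr
  exact norm_add_le v w

lemma norm_saddleField_le (v : EuclideanSpace ℝ (Fin 2)) : ‖saddleField v‖ ≤ ‖v‖ := by
  rw [saddleField, norm_smul, Real.norm_eq_abs, abs_div, abs_of_nonneg (sq_nonneg ‖v‖)]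
  exact mul_le_of_le_one_left (norm_nonneg v) (div_le_one_of_le₀ (abs_saddle_le v) (sq_nonneg _))

lemma norm_saddleField_sub_le {v w : EuclideanSpace ℝ (Fin 2)} (h : ‖w‖ ≤ ‖v‖) :
    ‖saddleField v - saddleField w‖ ≤ 5 * ‖v - w‖ := by
  rcases eq_or_ne w 0 with rfl | hw
  · have h0 : saddleField (0 : EuclideanSpace ℝ (Fin 2)) = 0 := by simp [saddleField]
    rw [h0, sub_zero, sub_zero]
    linarith [norm_saddleField_le v, norm_nonneg v]
  have hw' : 0 < ‖w‖ := norm_pos_iff.2 hw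
  have hv' : 0 < ‖v‖ := hw'.trans_le h
  have hsplit : saddleField v - saddleField w =
      (saddle v / ‖v‖ ^ 2) • (v - w) + ((saddle v - saddle w) / ‖v‖ ^ 2) • w
        + (saddle w / ‖w‖ ^ 2 * ((‖w‖ ^ 2 - ‖v‖ ^ 2) / ‖v‖ ^ 2)) • w := by
    have : saddle w / ‖w‖ ^ 2 * ((‖w‖ ^ 2 - ‖v‖ ^ 2) / ‖v‖ ^ 2)
        = saddle w / ‖v‖ ^ 2 - saddle w / ‖w‖ ^ 2 := by
      field_simp
    rw [this, saddleField, saddleField]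
    module
  have hc (u : EuclideanSpace ℝ (Fin 2)) : |saddle u / ‖u‖ ^ 2| ≤ 1 := by
    rw [abs_div, abs_of_nonneg (sq_nonneg ‖u‖)]
    exact div_le_one_of_le₀ (abs_saddle_le u) (sq_nonneg _)
  have hratio : (‖v - w‖ * (‖v‖ + ‖w‖)) / ‖v‖ ^ 2 * ‖w‖ ≤ 2 * ‖v - w‖ := by
    rw [div_mul_eq_mul_div, div_le_iff₀ (by positivity)]
    have : (‖v‖ + ‖w‖) * ‖w‖ ≤ 2 * ‖v‖ ^ 2 := by nlinarith
    nlinarith [norm_nonneg (v - w)]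
  have h1 : ‖(saddle v / ‖v‖ ^ 2) • (v - w)‖ ≤ ‖v - w‖ := by
    rw [norm_smul]
    exact mul_le_of_le_one_left (norm_nonneg _) (hc v)
  have h2 : ‖((saddle v - saddle w) / ‖v‖ ^ 2) • w‖ ≤ 2 * ‖v - w‖ := by
    refine le_trans ?_ hratio
    rw [norm_smul, Real.norm_eq_abs, abs_div, abs_of_nonneg (sq_nonneg ‖v‖)]
    gcongr
    exact abs_saddle_sub_le v w
  have h3 : ‖(saddle w / ‖w‖ ^ 2 * ((‖w‖ ^ 2 - ‖v‖ ^ 2) / ‖v‖ ^ 2)) • w‖ ≤ 2 * ‖v - w‖ := by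
    refine le_trans ?_ hratio
    rw [norm_smul, norm_mul, Real.norm_eq_abs, Real.norm_eq_abs]
    gcongr
    refine (mul_le_of_le_one_left (abs_nonneg _) (hc w)).trans ?_
    rw [abs_div, abs_of_nonneg (sq_nonneg ‖v‖)]
    gcongr
    rw [abs_sub_comm, abs_of_nonneg (by nlinarith)]
    nlinarith [norm_sub_norm_le v w]
  rw [hsplit]
  linarith [norm_add₃_le (a := (saddle v / ‖v‖ ^ 2) • (v - w))
    (b := ((saddle v - saddle w) / ‖v‖ ^ 2) • w)
    (c := (saddle w / ‖w‖ ^ 2 * ((‖w‖ ^ 2 - ‖v‖ ^ 2) / ‖v‖ ^ 2)) • w)]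

lemma sqrtNegLog_nonneg (r : ℝ) : 0 ≤ sqrtNegLog r := Real.sqrt_nonneg _

lemma sqrtNegLog_pos {r : ℝ} (h0 : 0 < r) (h1 : r < 1) : 0 < sqrtNegLog r :=
  Real.sqrt_pos.2 (neg_pos.2 (Real.log_neg h0 h1))

lemma sqrtNegLog_sq {r : ℝ} (h0 : 0 ≤ r) (h1 : r ≤ 1) : sqrtNegLog r ^ 2 = -Real.log r :=
  Real.sq_sqrt (neg_nonneg.2 (Real.log_nonpos h0 h1))

lemma sqrtNegLog_anti {r t : ℝ} (h0 : 0 < r) (h : r ≤ t) : sqrtNegLog t ≤ sqrtNegLog r :=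
  Real.sqrt_le_sqrt (neg_le_neg (Real.log_le_log h0 h))

lemma sqrtNegLog_mul_rpow_le {a r : ℝ} (ha : 0 < a) (h0 : 0 ≤ r) (h1 : r ≤ 1) :
    sqrtNegLog r * r ^ a ≤ 1 + a⁻¹ := by
  rcases h0.eq_or_lt with rfl | hr
  · rw [Real.zero_rpow ha.ne', mul_zero]; positivity
  have hlog : -Real.log r ≤ (r ^ a)⁻¹ / a := by
    have := Real.log_le_rpow_div (inv_nonneg.2 h0) ha
    rwa [Real.log_inv, Real.inv_rpow h0] at this
  have hp : 0 < r ^ a := Real.rpow_pos_of_pos hr a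
  have hp1 : r ^ a ≤ 1 := Real.rpow_le_one h0 h1 ha.le
  have hL : sqrtNegLog r ≤ 1 + (r ^ a)⁻¹ / a := by
    nlinarith [sqrtNegLog_sq h0 h1, sq_nonneg (sqrtNegLog r - 1), sqrtNegLog_nonneg r]
  calc sqrtNegLog r * r ^ a ≤ (1 + (r ^ a)⁻¹ / a) * r ^ a := by gcongr
    _ = r ^ a + a⁻¹ := by field_simp
    _ ≤ 1 + a⁻¹ := by gcongr

lemma sqrtNegLog_sub_mul_le {s r t : ℝ} (hs1 : s < 1) (ht : 0 < t) (htr : t ≤ r)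
    (hrs : r ≤ s) :
    (sqrtNegLog t - sqrtNegLog r) * t ≤ (sqrtNegLog s)⁻¹ * (r - t) := by
  have hr : 0 < r := ht.trans_le htr
  have hS : 0 < sqrtNegLog s := sqrtNegLog_pos (hr.trans_le hrs) hs1
  have hSr : sqrtNegLog s ≤ sqrtNegLog r := sqrtNegLog_anti hr hrs
  have hrt : sqrtNegLog r ≤ sqrtNegLog t := sqrtNegLog_anti ht htr
  have hlog : sqrtNegLog t ^ 2 - sqrtNegLog r ^ 2 ≤ r / t - 1 := by
    rw [sqrtNegLog_sq ht.le (by linarith), sqrtNegLog_sq hr.le (by linarith)]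
    have := Real.log_le_sub_one_of_pos (div_pos hr ht)
    rw [Real.log_div hr.ne' ht.ne'] at this
    linarith
  have hmul : (sqrtNegLog t ^ 2 - sqrtNegLog r ^ 2) * t ≤ r - t := by
    calc _ ≤ (r / t - 1) * t := by gcongr
      _ = r - t := by field_simp
  rw [inv_mul_eq_div, le_div_iff₀ hS]
  refine le_trans ?_ hmul
  have : (sqrtNegLog t - sqrtNegLog r) * sqrtNegLog s ≤ sqrtNegLog t ^ 2 - sqrtNegLog r ^ 2 := by
    nlinarith
  nlinarith

lemma norm_gradEx_sub_le {s : ℝ} (hs : s < 1) {v w : EuclideanSpace ℝ (Fin 2)} (hv : v ≠ 0)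
    (hvs : ‖v‖ ≤ s) (h : ‖w‖ ≤ ‖v‖) :
    ‖gradEx v - gradEx w‖ ≤ (2 * sqrtNegLog ‖v‖ + 5 * (sqrtNegLog s)⁻¹
      + (sqrtNegLog s)⁻¹ ^ 3) * ‖v - w‖ := by
  have hv' : 0 < ‖v‖ := norm_pos_iff.2 hv
  have hS : 0 < sqrtNegLog s := sqrtNegLog_pos (hv'.trans_le hvs) hs
  have hSv : sqrtNegLog s ≤ sqrtNegLog ‖v‖ := sqrtNegLog_anti hv' hvs
  have hdiff : |sqrtNegLog ‖v‖ - sqrtNegLog ‖w‖| * ‖w‖ ≤ (sqrtNegLog s)⁻¹ * ‖v - w‖ := by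
    rcases eq_or_ne w 0 with rfl | hw
    · rw [norm_zero, mul_zero]; positivity
    have hw' : 0 < ‖w‖ := norm_pos_iff.2 hw
    rw [abs_sub_comm, abs_of_nonneg (sub_nonneg.2 (sqrtNegLog_anti hw' h))]
    refine (sqrtNegLog_sub_mul_le hs hw' h hvs).trans ?_
    gcongr
    exact norm_sub_norm_le v w
  have hinv : |(sqrtNegLog ‖v‖)⁻¹ - (sqrtNegLog ‖w‖)⁻¹| * ‖w‖
      ≤ (sqrtNegLog s)⁻¹ ^ 3 * ‖v - w‖ := by
    rcases eq_or_ne w 0 with rfl | hw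
    · rw [norm_zero, mul_zero]; positivity
    have hw' : 0 < ‖w‖ := norm_pos_iff.2 hw
    have hSw : sqrtNegLog s ≤ sqrtNegLog ‖w‖ := sqrtNegLog_anti hw' (h.trans hvs)
    have hV : 0 < sqrtNegLog ‖v‖ := hS.trans_le hSv
    have hW : 0 < sqrtNegLog ‖w‖ := hS.trans_le hSw
    have e : (sqrtNegLog ‖v‖)⁻¹ - (sqrtNegLog ‖w‖)⁻¹
        = (sqrtNegLog ‖v‖)⁻¹ * (sqrtNegLog ‖w‖)⁻¹ * (sqrtNegLog ‖w‖ - sqrtNegLog ‖v‖) := by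
      field_simp
    rw [e, abs_mul, abs_of_pos (by positivity), abs_sub_comm, mul_assoc]
    calc _ ≤ (sqrtNegLog s)⁻¹ * (sqrtNegLog s)⁻¹ * ((sqrtNegLog s)⁻¹ * ‖v - w‖) := by gcongr
      _ = _ := by ring
  have hsplit : gradEx v - gradEx w =
      ((2 * sqrtNegLog ‖v‖) • (reflY v - reflY w)
        + (2 * (sqrtNegLog ‖v‖ - sqrtNegLog ‖w‖)) • reflY w)
      - ((2⁻¹ * (sqrtNegLog ‖v‖)⁻¹) • (saddleField v - saddleField w)
        + (2⁻¹ * ((sqrtNegLog ‖v‖)⁻¹ - (sqrtNegLog ‖w‖)⁻¹)) • saddleField w) := by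
    rw [gradEx, gradEx]; module
  have h1 : ‖(2 * sqrtNegLog ‖v‖) • (reflY v - reflY w)‖ = 2 * sqrtNegLog ‖v‖ * ‖v - w‖ := by
    rw [norm_smul, reflY_sub, norm_reflY, Real.norm_of_nonneg]
    exact mul_nonneg zero_le_two (sqrtNegLog_nonneg _)
  have h2 : ‖(2 * (sqrtNegLog ‖v‖ - sqrtNegLog ‖w‖)) • reflY w‖
      ≤ 2 * ((sqrtNegLog s)⁻¹ * ‖v - w‖) := by
    rw [norm_smul, norm_reflY, norm_mul, Real.norm_two, mul_assoc]
    exact mul_le_mul_of_nonneg_left hdiff zero_le_two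
  have h3 : ‖(2⁻¹ * (sqrtNegLog ‖v‖)⁻¹) • (saddleField v - saddleField w)‖
      ≤ 2⁻¹ * (sqrtNegLog s)⁻¹ * (5 * ‖v - w‖) := by
    rw [norm_smul, Real.norm_of_nonneg
      (mul_nonneg (by norm_num) (inv_nonneg.2 (sqrtNegLog_nonneg _)))]
    gcongr
    exact norm_saddleField_sub_le h
  have h4 : ‖(2⁻¹ * ((sqrtNegLog ‖v‖)⁻¹ - (sqrtNegLog ‖w‖)⁻¹)) • saddleField w‖
      ≤ 2⁻¹ * ((sqrtNegLog s)⁻¹ ^ 3 * ‖v - w‖) := by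
    rw [norm_smul, norm_mul, norm_inv, Real.norm_two, mul_assoc]
    refine mul_le_mul_of_nonneg_left (le_trans ?_ hinv) (by norm_num)
    rw [Real.norm_eq_abs]
    gcongr
    exact norm_saddleField_le w
  have hp : 0 ≤ (sqrtNegLog s)⁻¹ * ‖v - w‖ := by positivity
  have hp3 : 0 ≤ (sqrtNegLog s)⁻¹ ^ 3 * ‖v - w‖ := by positivity
  rw [hsplit]
  refine norm_sub_le_of_le (norm_add_le _ _) (norm_add_le _ _) |>.trans ?_
  nlinarith

/-- The gradient field `gradEx` is `β`-Hölder on every disc of radius less than one. -/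
lemma gradEx_holder {s β : ℝ} (hs : s ∈ Ioo (0 : ℝ) 1) (hβ : β ∈ Ioo (0 : ℝ) 1) :
    ∃ C : ℝ, 0 ≤ C ∧ ∀ x ∈ ball (0 : EuclideanSpace ℝ (Fin 2)) s,
      ∀ y ∈ ball (0 : EuclideanSpace ℝ (Fin 2)) s,
        ‖gradEx x - gradEx y‖ ≤ C * ‖x - y‖ ^ β := by
  have hS : 0 < sqrtNegLog s := sqrtNegLog_pos hs.1 hs.2
  have hβ' : 0 < 1 - β := by linarith [hβ.2]
  set A : ℝ := 5 * (sqrtNegLog s)⁻¹ + (sqrtNegLog s)⁻¹ ^ 3 with hA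
  have hA0 : 0 ≤ A := by positivity
  set C : ℝ := (2 * (1 + (1 - β)⁻¹) + A) * 2 with hC
  have hC0 : 0 ≤ C := by positivity
  have key : ∀ x y : EuclideanSpace ℝ (Fin 2), ‖x‖ < s → ‖y‖ ≤ ‖x‖ →
      ‖gradEx x - gradEx y‖ ≤ C * ‖x - y‖ ^ β := by
    intro x y hx hyx
    rcases eq_or_ne x y with rfl | hxy
    · rw [sub_self, norm_zero]
      positivity
    have hx0 : x ≠ 0 := by
      rintro rfl
      rw [norm_zero] at hyx
      exact hxy (norm_le_zero_iff.1 hyx).symm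
    have hd : 0 < ‖x - y‖ := norm_pos_iff.2 (sub_ne_zero.2 hxy)
    have hd2 : ‖x - y‖ ≤ 2 * ‖x‖ := by linarith [norm_sub_le x y]
    have hx1 : ‖x‖ ≤ 1 := (hx.trans hs.2).le
    have hpow : ‖x - y‖ ≤ 2 * ‖x‖ ^ (1 - β) * ‖x - y‖ ^ β := by
      calc ‖x - y‖ = ‖x - y‖ ^ (1 - β) * ‖x - y‖ ^ β := by
            rw [← Real.rpow_add hd]; simp
        _ ≤ (2 * ‖x‖) ^ (1 - β) * ‖x - y‖ ^ β := by gcongr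
        _ = 2 ^ (1 - β) * ‖x‖ ^ (1 - β) * ‖x - y‖ ^ β := by
            rw [Real.mul_rpow zero_le_two (norm_nonneg x)]
        _ ≤ 2 * ‖x‖ ^ (1 - β) * ‖x - y‖ ^ β := by
            gcongr
            calc (2 : ℝ) ^ (1 - β) ≤ 2 ^ (1 : ℝ) :=
                  Real.rpow_le_rpow_of_exponent_le one_le_two (by linarith [hβ.1])
              _ = 2 := Real.rpow_one 2
    have hL := sqrtNegLog_mul_rpow_le hβ' (norm_nonneg x) hx1
    have hp1 : ‖x‖ ^ (1 - β) ≤ 1 := Real.rpow_le_one (norm_nonneg x) hx1 hβ'.le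
    have hLn := sqrtNegLog_nonneg ‖x‖
    calc ‖gradEx x - gradEx y‖ ≤ (2 * sqrtNegLog ‖x‖ + A) * ‖x - y‖ := by
          rw [hA, ← add_assoc]
          exact norm_gradEx_sub_le hs.2 hx0 hx.le hyx
      _ ≤ (2 * sqrtNegLog ‖x‖ + A) * (2 * ‖x‖ ^ (1 - β) * ‖x - y‖ ^ β) := by gcongr
      _ = (2 * (sqrtNegLog ‖x‖ * ‖x‖ ^ (1 - β)) + A * ‖x‖ ^ (1 - β)) * 2 * ‖x - y‖ ^ β := by
          ring
      _ ≤ (2 * (1 + (1 - β)⁻¹) + A * 1) * 2 * ‖x - y‖ ^ β := by gcongr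
      _ = C * ‖x - y‖ ^ β := by rw [hC, mul_one]
  refine ⟨C, hC0, fun x hx y hy => ?_⟩
  rw [mem_ball_zero_iff] at hx hy
  rcases le_total ‖y‖ ‖x‖ with h | h
  · exact key x y hx h
  · rw [norm_sub_rev, norm_sub_rev x y]
    exact key y x hy h

lemma hasGradientAt_fEx_zero : HasGradientAt fEx 0 0 := by
  rw [hasGradientAt_iff_hasFDerivAt, map_zero]
  refine HasFDerivAt.of_isLittleO ?_
  have h0 : fEx 0 = 0 := by simp [fEx]
  simp only [h0, sub_zero, zero_apply]
  have hlim : Filter.Tendsto (fun v : EuclideanSpace ℝ (Fin 2) => ‖v‖ ^ (2⁻¹ : ℝ))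
      (nhds 0) (nhds 0) := by
    have hc : Continuous fun v : EuclideanSpace ℝ (Fin 2) => ‖v‖ ^ (2⁻¹ : ℝ) :=
      continuous_norm.rpow_const fun _ => Or.inr (by norm_num)
    simpa using hc.tendsto 0
  have hO : fEx =O[nhds 0] fun v => ‖v‖ ^ (2⁻¹ : ℝ) * ‖v‖ := by
    refine Asymptotics.IsBigO.of_bound (1 + (2⁻¹ : ℝ)⁻¹) ?_
    filter_upwards [ball_mem_nhds (0 : EuclideanSpace ℝ (Fin 2)) one_pos] with v hv
    rw [mem_ball_zero_iff] at hv
    have hL := sqrtNegLog_mul_rpow_le (a := 2⁻¹) (by norm_num) (norm_nonneg v) hv.le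
    have hhalf : ‖v‖ ^ (2⁻¹ : ℝ) * ‖v‖ ^ (2⁻¹ : ℝ) = ‖v‖ := by
      rw [← Real.rpow_add_of_nonneg (norm_nonneg v) (by norm_num) (by norm_num)]
      norm_num
    have hp : 0 ≤ ‖v‖ ^ (2⁻¹ : ℝ) := Real.rpow_nonneg (norm_nonneg v) _
    rw [fEx_eq, norm_mul, Real.norm_of_nonneg (sqrtNegLog_nonneg _), Real.norm_eq_abs,
      Real.norm_of_nonneg (mul_nonneg hp (norm_nonneg v))]
    calc |saddle v| * sqrtNegLog ‖v‖ ≤ ‖v‖ ^ 2 * sqrtNegLog ‖v‖ :=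
          mul_le_mul_of_nonneg_right (abs_saddle_le v) (sqrtNegLog_nonneg _)
      _ = sqrtNegLog ‖v‖ * (‖v‖ ^ (2⁻¹ : ℝ) * ‖v‖ ^ (2⁻¹ : ℝ)) * ‖v‖ := by rw [hhalf]; ring
      _ = sqrtNegLog ‖v‖ * ‖v‖ ^ (2⁻¹ : ℝ) * (‖v‖ ^ (2⁻¹ : ℝ) * ‖v‖) := by ring
      _ ≤ _ := by gcongr
  have ho : (fun v : EuclideanSpace ℝ (Fin 2) => ‖v‖ ^ (2⁻¹ : ℝ) * ‖v‖) =o[nhds 0]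
      fun v : EuclideanSpace ℝ (Fin 2) => v := by
    have := ((Asymptotics.isLittleO_one_iff ℝ).2 hlim).mul_isBigO
      (Asymptotics.isBigO_refl (fun v : EuclideanSpace ℝ (Fin 2) => ‖v‖) (nhds 0))
    rw [← Asymptotics.isLittleO_norm_right]
    simpa only [one_mul] using this
  exact hO.trans_isLittleO ho

lemma hasGradientAt_fEx {v : EuclideanSpace ℝ (Fin 2)} (hv : ‖v‖ < 1) :
    HasGradientAt fEx (gradEx v) v := by
  rcases eq_or_ne v 0 with rfl | hv0
  · have h : gradEx 0 = 0 := by simp [gradEx, sqrtNegLog]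
    rw [h]
    exact hasGradientAt_fEx_zero
  have hn : 0 < ‖v‖ := norm_pos_iff.2 hv0
  have hlog : -Real.log ‖v‖ ≠ 0 := neg_ne_zero.2 (Real.log_neg hn hv).ne
  have hL : 0 < sqrtNegLog ‖v‖ := sqrtNegLog_pos hn hv
  have hcoord (i : Fin 2) : HasFDerivAt (fun u : EuclideanSpace ℝ (Fin 2) => u i)
      (EuclideanSpace.proj i : EuclideanSpace ℝ (Fin 2) →L[ℝ] ℝ) v :=
    (EuclideanSpace.proj i : EuclideanSpace ℝ (Fin 2) →L[ℝ] ℝ).hasFDerivAt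
  have hq := ((hcoord 0).pow 2).sub ((hcoord 1).pow 2)
  have hN := (hasStrictFDerivAt_norm_sq v).hasFDerivAt
  have hl := ((hN.log (pow_ne_zero 2 hn.ne')).const_mul (-2⁻¹ : ℝ))
  have hval (u : EuclideanSpace ℝ (Fin 2)) : -2⁻¹ * Real.log (‖u‖ ^ 2) = -Real.log ‖u‖ := by
    rw [Real.log_pow]; push_cast; ring
  have hf := hq.mul (hl.sqrt (by rw [hval]; exact hlog))
  rw [hasGradientAt_iff_hasFDerivAt]
  have hfun : fEx = fun u => (u 0 ^ 2 - u 1 ^ 2) * Real.sqrt (-2⁻¹ * Real.log (‖u‖ ^ 2)) := by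
    funext u
    rw [hval, fEx_eq, saddle, sqrtNegLog]
  rw [hfun]
  refine hf.congr_fderiv ?_
  ext w
  rw [hval]
  change _ = inner ℝ (gradEx v) w
  have e : Real.sqrt (-Real.log ‖v‖) = sqrtNegLog ‖v‖ := rfl
  rw [e]
  simp [gradEx, saddleField, saddle, reflY, PiLp.inner_apply, Fin.sum_univ_two]
  field_simp
  ring

lemma gradient_fEx {v : EuclideanSpace ℝ (Fin 2)} (hv : ‖v‖ < 1) :
    gradient fEx v = gradEx v :=
  (hasGradientAt_fEx hv).gradient

lemma gradEx_single {t : ℝ} (ht : 0 < t) :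
    gradEx !₂[t, 0] = (2 * sqrtNegLog t - 2⁻¹ * (sqrtNegLog t)⁻¹) • !₂[t, 0] := by
  have hn : ‖(!₂[t, 0] : EuclideanSpace ℝ (Fin 2))‖ = t := by
    simp [EuclideanSpace.norm_eq, Fin.sum_univ_two, Real.sqrt_sq ht.le]
  have hr : reflY !₂[t, 0] = !₂[t, 0] := by simp [reflY]
  have hs : saddleField !₂[t, 0] = !₂[t, 0] := by
    rw [saddleField, hn]
    simp [saddle, ht.ne']
  rw [gradEx, hn, hr, hs, sub_smul]

/-- The gradient of `fEx` is not Lipschitz on any disc around the origin. -/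
lemma not_lipschitz_gradient_fEx {ε : ℝ} (hε : 0 < ε) :
    ¬ ∃ C : ℝ, ∀ x ∈ ball (0 : EuclideanSpace ℝ (Fin 2)) ε,
        ∀ y ∈ ball (0 : EuclideanSpace ℝ (Fin 2)) ε,
          ‖gradient fEx x - gradient fEx y‖ ≤ C * ‖x - y‖ := by
  rintro ⟨C, hC⟩
  set M : ℝ := |C| + |Real.log ε| + 1 with hM
  have hM1 : 1 ≤ M := by linarith [abs_nonneg C, abs_nonneg (Real.log ε)]
  have hMM : M ≤ M ^ 2 := by nlinarith
  set t : ℝ := Real.exp (-M ^ 2) with ht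
  have ht0 : 0 < t := Real.exp_pos _
  have ht1 : t < 1 := Real.exp_lt_one_iff.2 (by linarith)
  have htε : t < ε := by
    rw [ht, ← Real.lt_log_iff_exp_lt hε]
    linarith [neg_abs_le (Real.log ε), abs_nonneg C]
  have hL : sqrtNegLog t = M := by
    rw [sqrtNegLog, ht, Real.log_exp, neg_neg, Real.sqrt_sq (by linarith)]
  have hn : ‖(!₂[t, 0] : EuclideanSpace ℝ (Fin 2))‖ = t := by
    simp [EuclideanSpace.norm_eq, Fin.sum_univ_two, Real.sqrt_sq ht0.le]
  have h := hC !₂[t, 0] (by rwa [mem_ball_zero_iff, hn]) 0 (mem_ball_self hε)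
  rw [hasGradientAt_fEx_zero.gradient, gradient_fEx (by rwa [hn]), sub_zero, sub_zero,
    gradEx_single ht0, norm_smul, hn, hL] at h
  have h' := (le_abs_self _).trans (le_of_mul_le_mul_right h ht0)
  have hinv : M⁻¹ ≤ 1 := inv_le_one_of_one_le₀ hM1
  linarith [le_abs_self C, abs_nonneg (Real.log ε)]

/-- `f` is `C^{1,β}` on `B_s(0)` for every `β ∈ (0,1)` and every
`s ∈ (0,1)`, but the gradient of `f` is not Lipschitz on any neighborhood of `0`. -/
theorem stmt19 (s : ℝ) (hs : s ∈ Set.Ioo (0 : ℝ) 1) :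
    ContDiffOn ℝ 1 fEx (ball (0 : EuclideanSpace ℝ (Fin 2)) s) ∧
    (∀ β ∈ Set.Ioo (0 : ℝ) 1, ∃ C : ℝ, 0 ≤ C ∧
      ∀ x ∈ ball (0 : EuclideanSpace ℝ (Fin 2)) s,
        ∀ y ∈ ball (0 : EuclideanSpace ℝ (Fin 2)) s,
          ‖gradient fEx x - gradient fEx y‖ ≤ C * ‖x - y‖ ^ β) ∧
    (∀ ε : ℝ, 0 < ε →
      ¬ ∃ C : ℝ, ∀ x ∈ ball (0 : EuclideanSpace ℝ (Fin 2)) ε,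
        ∀ y ∈ ball (0 : EuclideanSpace ℝ (Fin 2)) ε,
          ‖gradient fEx x - gradient fEx y‖ ≤ C * ‖x - y‖) := by
  have hlt {v : EuclideanSpace ℝ (Fin 2)} (hv : v ∈ ball 0 s) : ‖v‖ < 1 :=
    (mem_ball_zero_iff.1 hv).trans hs.2
  refine ⟨?_, fun β hβ => ?_, fun ε hε => not_lipschitz_gradient_fEx hε⟩
  · have hcont : ContinuousOn gradEx (ball 0 s) := by
      obtain ⟨C, hC0, hC⟩ := gradEx_holder hs (β := 2⁻¹) ⟨by norm_num, by norm_num⟩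
      intro v hv
      rw [ContinuousWithinAt, tendsto_iff_norm_sub_tendsto_zero]
      have hc : Continuous fun x : EuclideanSpace ℝ (Fin 2) => C * ‖x - v‖ ^ (2⁻¹ : ℝ) :=
        continuous_const.mul
          ((continuous_id.sub continuous_const).norm.rpow_const fun _ => Or.inr (by norm_num))
      have hlim := (hc.tendsto v).mono_left (nhdsWithin_le_nhds (s := ball 0 s))
      rw [sub_self, norm_zero, Real.zero_rpow (by norm_num), mul_zero] at hlim
      exact squeeze_zero' (Filter.Eventually.of_forall fun _ => norm_nonneg _)
        (Filter.eventually_of_mem self_mem_nhdsWithin fun x hx => hC x hx v hv) hlim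
    have hderiv {v : EuclideanSpace ℝ (Fin 2)} (hv : v ∈ ball 0 s) :=
      (hasGradientAt_fEx (hlt hv)).hasFDerivAt
    rw [← zero_add (1 : WithTop ℕ∞), contDiffOn_succ_iff_fderiv_of_isOpen isOpen_ball]
    refine ⟨fun v hv => (hderiv hv).differentiableAt.differentiableWithinAt, by simp, ?_⟩
    rw [contDiffOn_zero]
    refine ((InnerProductSpace.toDual ℝ (EuclideanSpace ℝ (Fin 2))).continuous.comp_continuousOn
      hcont).congr fun v hv => ?_
    exact (hderiv hv).fderiv
  · obtain ⟨C, hC0, hC⟩ := gradEx_holder hs hβ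
    refine ⟨C, hC0, fun x hx y hy => ?_⟩
    rw [gradient_fEx (hlt hx), gradient_fEx (hlt hy)]
    exact hC x hx y hy
end
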